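/- For every r > 0, the image under μ_ℍ of the open ball {q ∈ ℍ : ‖q‖ < r} is exactly the set {p ∈ ℍ : p is purely imaginary and ‖p‖ < r²/2}. -/

import Mathlib

open Quaternion

/-- The imaginary quaternion unit `i`. -/
def quatI : ℍ[ℝ] := ⟨0, 1, 0, 0⟩

/-- The hyperKähler moment map of the standard circle action on `ℍ`,
`μ_ℍ(q) = (1/2)·(q̄ i q)`. -/
noncomputable def muH (q : ℍ[ℝ]) : ℍ[ℝ] :=
  (1 / 2 : ℝ) • (star q * quatI * q)

lemma norm_quatI : ‖quatI‖ = 1 := by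
  have h : ‖quatI‖ * ‖quatI‖ = 1 := by
    rw [← normSq_eq_norm_mul_self, normSq_def']
    simp [quatI]
  nlinarith [norm_nonneg quatI]

lemma norm_muH (q : ℍ[ℝ]) : ‖muH q‖ = ‖q‖ ^ 2 / 2 := by
  rw [muH, norm_smul, norm_mul, norm_mul, norm_star, norm_quatI, Real.norm_of_nonneg (by norm_num)]
  ring

@[simp] lemma re_quatI : quatI.re = 0 := rfl

@[simp] lemma imI_quatI : quatI.imI = 1 := rfl

@[simp] lemma imJ_quatI : quatI.imJ = 0 := rfl

@[simp] lemma imK_quatI : quatI.imK = 0 := rfl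

lemma re_muH (q : ℍ[ℝ]) : (muH q).re = 0 := by
  simp [muH]
  ring

lemma imI_muH (q : ℍ[ℝ]) : (muH q).imI = (q.re ^ 2 + q.imI ^ 2 - q.imJ ^ 2 - q.imK ^ 2) / 2 := by
  simp [muH]
  ring

lemma imJ_muH (q : ℍ[ℝ]) : (muH q).imJ = q.imI * q.imJ - q.re * q.imK := by
  simp [muH]
  ring

lemma imK_muH (q : ℍ[ℝ]) : (muH q).imK = q.imI * q.imK + q.re * q.imJ := by
  simp [muH]
  ring

/-- The moment map sends the purely imaginary quaternion with coordinates `b`, `c`, `d` to the one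
with coordinates `(b² - c² - d²) / 2`, `b c`, `b d`. -/
lemma muH_imaginary_eq {p : ℍ[ℝ]} (hp : p.re = 0) {b c d : ℝ}
    (hi : (b ^ 2 - c ^ 2 - d ^ 2) / 2 = p.imI) (hj : b * c = p.imJ) (hk : b * d = p.imK) :
    muH ⟨0, b, c, d⟩ = p := by
  ext
  · exact (re_muH _).trans hp.symm
  · exact (imI_muH _).trans (by linear_combination hi)
  · exact (imJ_muH _).trans (by linear_combination hj)
  · exact (imK_muH _).trans (by linear_combination hk)

/-- Every purely imaginary quaternion is a value of the moment map. -/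
lemma exists_muH_eq {p : ℍ[ℝ]} (hp : p.re = 0) : ∃ q, muH q = p := by
  have hsq : ‖p‖ * ‖p‖ = p.imI ^ 2 + p.imJ ^ 2 + p.imK ^ 2 := by
    rw [← normSq_eq_norm_mul_self, normSq_def', hp]
    ring
  have hn : 0 ≤ ‖p‖ := norm_nonneg p
  have hx : 0 ≤ ‖p‖ + p.imI := by nlinarith [sq_nonneg p.imJ, sq_nonneg p.imK]
  rcases hx.eq_or_lt with h | h
  · have hxn : p.imI = -‖p‖ := by linarith
    have hjk : p.imJ ^ 2 + p.imK ^ 2 = 0 := by rw [hxn] at hsq; linarith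
    have hj : p.imJ = 0 := by nlinarith [sq_nonneg p.imJ, sq_nonneg p.imK]
    have hk : p.imK = 0 := by nlinarith [sq_nonneg p.imK]
    refine ⟨⟨0, 0, √(2 * ‖p‖), 0⟩, muH_imaginary_eq hp ?_ (by simp [hj]) (by simp [hk])⟩
    rw [Real.sq_sqrt (by positivity)]
    linarith
  · have hb : √(‖p‖ + p.imI) ≠ 0 := (Real.sqrt_pos.2 h).ne'
    refine ⟨⟨0, √(‖p‖ + p.imI), p.imJ / √(‖p‖ + p.imI), p.imK / √(‖p‖ + p.imI)⟩,
      muH_imaginary_eq hp ?_ (mul_div_cancel₀ _ hb) (mul_div_cancel₀ _ hb)⟩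
    rw [div_pow, div_pow, Real.sq_sqrt hx]
    field_simp
    linarith

/-- For every `r > 0`, the image under `μ_ℍ` of the open ball of radius `r` in `ℍ`
is exactly the set of purely imaginary quaternions of norm less than `r²/2`. -/
theorem stmt7 (r : ℝ) (hr : 0 < r) :
    muH '' {q : ℍ[ℝ] | ‖q‖ < r} = {p : ℍ[ℝ] | p.re = 0 ∧ ‖p‖ < r ^ 2 / 2} := by
  ext p
  constructor
  · rintro ⟨q, hq, rfl⟩
    refine ⟨re_muH q, ?_⟩
    rw [norm_muH]
    have : ‖q‖ ^ 2 < r ^ 2 := pow_lt_pow_left₀ hq (norm_nonneg q) two_ne_zero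
    linarith
  · rintro ⟨hre, hp⟩
    obtain ⟨q, rfl⟩ := exists_muH_eq hre
    refine ⟨q, ?_, rfl⟩
    rw [norm_muH] at hp
    exact lt_of_pow_lt_pow_left₀ 2 hr.le (by linarith)
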